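/- Let α, β ∈ ℂ and let f = y^3 (α x^7 + β y^7) ∈ V_10. Then the ten invariants j_2, j_4, j_6, A_6, B_6, j_8, j_9, j_10, A_12 and A_14 all vanish at f, while j_14(f) ≠ 0 if and only if α ≠ 0 and β ≠ 0. In particular, the invariant j_14 cannot be omitted from the eleven invariants j_2, j_4, j_6, A_6, B_6, j_8, j_9, j_10, A_12, j_14, A_14 defining the nullcone of V_10. -/

import Mathlib

open MvPolynomial

/-- The `k`-th transvectant of two binary forms `f` of degree `n` and `g` of degree `m`. -/
noncomputable def transv (n m k : ℕ)
    (f g : MvPolynomial (Fin 2) ℂ) : MvPolynomial (Fin 2) ℂ :=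
  ((((n - k).factorial * (m - k).factorial : ℕ) : ℂ) / ((n.factorial * m.factorial : ℕ) : ℂ)) •
    ∑ i ∈ Finset.range (k + 1),
      ((-1 : ℂ) ^ i * (k.choose i : ℂ)) •
        ((fun p => pderiv (0 : Fin 2) p)^[k - i] ((fun p => pderiv (1 : Fin 2) p)^[i] f) *
         (fun p => pderiv (0 : Fin 2) p)^[i] ((fun p => pderiv (1 : Fin 2) p)^[k - i] g))

/-- A binary form `f` has a root of multiplicity (at least) `r` if some nonzero linear
form `ℓ = αx + βy` satisfies `ℓ^r ∣ f`. -/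
def HasRootOfMult (r : ℕ) (f : MvPolynomial (Fin 2) ℂ) : Prop :=
  ∃ a b : ℂ, (a ≠ 0 ∨ b ≠ 0) ∧ (C a * X 0 + C b * X 1) ^ r ∣ f

/-- The covariant `k = (f,f)₈ ∈ V₄` of a binary decimic `f`. -/
noncomputable def covK (f : MvPolynomial (Fin 2) ℂ) : MvPolynomial (Fin 2) ℂ :=
  transv 10 10 8 f f

/-- The covariant `m = (f,k)₄ ∈ V₆` of a binary decimic `f`. -/
noncomputable def covM (f : MvPolynomial (Fin 2) ℂ) : MvPolynomial (Fin 2) ℂ :=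
  transv 10 4 4 f (covK f)

/-- The covariant `q = (f,f)₆ ∈ V₈` of a binary decimic `f`. -/
noncomputable def covQ (f : MvPolynomial (Fin 2) ℂ) : MvPolynomial (Fin 2) ℂ :=
  transv 10 10 6 f f

/-- The covariant `r = (f,q)₈ ∈ V₂` of a binary decimic `f`. -/
noncomputable def covR (f : MvPolynomial (Fin 2) ℂ) : MvPolynomial (Fin 2) ℂ :=
  transv 10 8 8 f (covQ f)

/-- The covariant `k_q = (q,q)₆ ∈ V₄` of a binary decimic `f`. -/
noncomputable def covKq (f : MvPolynomial (Fin 2) ℂ) : MvPolynomial (Fin 2) ℂ :=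
  transv 8 8 6 (covQ f) (covQ f)

/-- The covariant `k_m = (m,m)₄ ∈ V₄` of a binary decimic `f`. -/
noncomputable def covKm (f : MvPolynomial (Fin 2) ℂ) : MvPolynomial (Fin 2) ℂ :=
  transv 6 6 4 (covM f) (covM f)

/-- The covariant `m_q = (q,k_q)₄ ∈ V₄` of a binary decimic `f`. -/
noncomputable def covMq (f : MvPolynomial (Fin 2) ℂ) : MvPolynomial (Fin 2) ℂ :=
  transv 8 4 4 (covQ f) (covKq f)

/-- The invariant `j₂ = (f,f)₁₀` of a binary decimic `f` (a form of order 0, i.e. a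
constant polynomial). -/
noncomputable def j2 (f : MvPolynomial (Fin 2) ℂ) : MvPolynomial (Fin 2) ℂ :=
  transv 10 10 10 f f

/-- The invariant `j₄ = (k,k)₄` of a binary decimic `f`. -/
noncomputable def j4 (f : MvPolynomial (Fin 2) ℂ) : MvPolynomial (Fin 2) ℂ :=
  transv 4 4 4 (covK f) (covK f)

/-- The invariant `j₆ = ((k,k)₂,k)₄` of a binary decimic `f`. -/
noncomputable def j6 (f : MvPolynomial (Fin 2) ℂ) : MvPolynomial (Fin 2) ℂ :=
  transv 4 4 4 (transv 4 4 2 (covK f) (covK f)) (covK f)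

/-- The invariant `A₆ = (m,m)₆` of a binary decimic `f`. -/
noncomputable def A6 (f : MvPolynomial (Fin 2) ℂ) : MvPolynomial (Fin 2) ℂ :=
  transv 6 6 6 (covM f) (covM f)

/-- The invariant `B₆ = ((q,q)₄,q)₈` of a binary decimic `f`. -/
noncomputable def B6 (f : MvPolynomial (Fin 2) ℂ) : MvPolynomial (Fin 2) ℂ :=
  transv 8 8 8 (transv 8 8 4 (covQ f) (covQ f)) (covQ f)

/-- The invariant `C₆ = (r,r)₂` of a binary decimic `f`. -/
noncomputable def C6 (f : MvPolynomial (Fin 2) ℂ) : MvPolynomial (Fin 2) ℂ :=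
  transv 2 2 2 (covR f) (covR f)

/-- The invariant `j₈ = (k,k_m)₄` of a binary decimic `f`. -/
noncomputable def j8 (f : MvPolynomial (Fin 2) ℂ) : MvPolynomial (Fin 2) ℂ :=
  transv 4 4 4 (covK f) (covKm f)

/-- The invariant `j₉ = ((m,k)₁,k²)₈` of a binary decimic `f`. -/
noncomputable def j9 (f : MvPolynomial (Fin 2) ℂ) : MvPolynomial (Fin 2) ℂ :=
  transv 8 8 8 (transv 6 4 1 (covM f) (covK f)) (covK f ^ 2)

/-- The invariant `j₁₀ = ((m,m)₂,k²)₈` of a binary decimic `f`. -/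
noncomputable def j10 (f : MvPolynomial (Fin 2) ℂ) : MvPolynomial (Fin 2) ℂ :=
  transv 8 8 8 (transv 6 6 2 (covM f) (covM f)) (covK f ^ 2)

/-- The invariant `A₁₂ = (m²,k³)₁₂` of a binary decimic `f`. -/
noncomputable def A12 (f : MvPolynomial (Fin 2) ℂ) : MvPolynomial (Fin 2) ℂ :=
  transv 12 12 12 (covM f ^ 2) (covK f ^ 3)

/-- The invariant `j₁₄ = ((k_q,k_q)₂,m_q)₄` of a binary decimic `f`. -/
noncomputable def j14 (f : MvPolynomial (Fin 2) ℂ) : MvPolynomial (Fin 2) ℂ :=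
  transv 4 4 4 (transv 4 4 2 (covKq f) (covKq f)) (covMq f)

/-- The invariant `A₁₄ = (((k,k)₂)²,(m,m)₂)₈` of a binary decimic `f`. -/
noncomputable def A14 (f : MvPolynomial (Fin 2) ℂ) : MvPolynomial (Fin 2) ℂ :=
  transv 8 8 8 (transv 4 4 2 (covK f) (covK f) ^ 2) (transv 6 6 2 (covM f) (covM f))

/-- The binary monomial `a x^p y^q`. -/
noncomputable def binMon (a : ℂ) (p q : ℕ) : MvPolynomial (Fin 2) ℂ :=
  C a * (X 0 ^ p * X 1 ^ q)

/-- The scalar by which the `k`-th transvectant acts on `x^p y^q` and `x^r y^s`. -/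
noncomputable def transvCoeff (n m k p q r s : ℕ) : ℂ :=
  ((((n - k).factorial * (m - k).factorial : ℕ) : ℂ) / ((n.factorial * m.factorial : ℕ) : ℂ)) *
    ∑ i ∈ Finset.range (k + 1), (-1 : ℂ) ^ i * (k.choose i : ℂ) *
      ((q.descFactorial i * p.descFactorial (k - i) *
        (s.descFactorial (k - i) * r.descFactorial i) : ℕ) : ℂ)

@[simp]
lemma binMon_zero (p q : ℕ) : binMon 0 p q = 0 := by simp [binMon]

lemma pderiv_zero_iterate_binMon (j : ℕ) (a : ℂ) (p q : ℕ) :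
    (fun f => pderiv (0 : Fin 2) f)^[j] (binMon a p q) =
      binMon (a * (p.descFactorial j : ℂ)) (p - j) q := by
  induction j with
  | zero => simp
  | succ j ih =>
    rw [Function.iterate_succ_apply', ih]
    simp only [binMon, Derivation.leibniz, Derivation.leibniz_pow, pderiv_C, pderiv_X_self,
      pderiv_X_of_ne (show (1 : Fin 2) ≠ 0 by decide), Nat.descFactorial_succ, Nat.sub_sub]
    simp
    ring

lemma pderiv_one_iterate_binMon (j : ℕ) (a : ℂ) (p q : ℕ) :
    (fun f => pderiv (1 : Fin 2) f)^[j] (binMon a p q) =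
      binMon (a * (q.descFactorial j : ℂ)) p (q - j) := by
  induction j with
  | zero => simp
  | succ j ih =>
    rw [Function.iterate_succ_apply', ih]
    simp only [binMon, Derivation.leibniz, Derivation.leibniz_pow, pderiv_C, pderiv_X_self,
      pderiv_X_of_ne (show (0 : Fin 2) ≠ 1 by decide), Nat.descFactorial_succ, Nat.sub_sub]
    simp
    ring

lemma pderiv_iterate_add (j : ℕ) (v : Fin 2) (f g : MvPolynomial (Fin 2) ℂ) :
    (fun p => pderiv v p)^[j] (f + g) =
      (fun p => pderiv v p)^[j] f + (fun p => pderiv v p)^[j] g :=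
  iterate_map_add (pderiv v) j f g

lemma transv_add_left (n m k : ℕ) (f g h : MvPolynomial (Fin 2) ℂ) :
    transv n m k (f + g) h = transv n m k f h + transv n m k g h := by
  simp only [transv, pderiv_iterate_add, add_mul, smul_add, Finset.sum_add_distrib]

lemma transv_add_right (n m k : ℕ) (f g h : MvPolynomial (Fin 2) ℂ) :
    transv n m k f (g + h) = transv n m k f g + transv n m k f h := by
  simp only [transv, pderiv_iterate_add, mul_add, smul_add, Finset.sum_add_distrib]

@[simp]
lemma transv_zero_left (n m k : ℕ) (f : MvPolynomial (Fin 2) ℂ) : transv n m k 0 f = 0 := by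
  simpa using transv_add_left n m k 0 0 f

@[simp]
lemma transv_zero_right (n m k : ℕ) (f : MvPolynomial (Fin 2) ℂ) : transv n m k f 0 = 0 := by
  simpa using transv_add_right n m k f 0 0

/-- A transvectant of two monomials is again a monomial. -/
lemma transv_binMon (n m k : ℕ) (a b : ℂ) (p q r s : ℕ) :
    transv n m k (binMon a p q) (binMon b r s) =
      binMon (transvCoeff n m k p q r s * (a * b)) (p + r - k) (q + s - k) := by
  simp only [transv, pderiv_zero_iterate_binMon, pderiv_one_iterate_binMon]
  have hterm : ∀ i ∈ Finset.range (k + 1),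
      ((-1 : ℂ) ^ i * (k.choose i : ℂ)) •
        (binMon (a * (q.descFactorial i : ℂ) * (p.descFactorial (k - i) : ℂ))
            (p - (k - i)) (q - i) *
          binMon (b * (s.descFactorial (k - i) : ℂ) * (r.descFactorial i : ℂ))
            (r - i) (s - (k - i))) =
      C ((-1 : ℂ) ^ i * (k.choose i : ℂ) *
        ((q.descFactorial i * p.descFactorial (k - i) *
          (s.descFactorial (k - i) * r.descFactorial i) : ℕ) : ℂ)) *
        binMon (a * b) (p + r - k) (q + s - k) := by
    intro i hi
    have hik : i ≤ k := Nat.lt_succ_iff.mp (Finset.mem_range.mp hi)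
    by_cases h : i ≤ q ∧ k - i ≤ p ∧ k - i ≤ s ∧ i ≤ r
    · have hx : p + r - k = (p - (k - i)) + (r - i) := by omega
      have hy : q + s - k = (q - i) + (s - (k - i)) := by omega
      rw [hx, hy, smul_eq_C_mul]
      simp only [binMon, pow_add, Nat.cast_mul, map_mul]
      ring
    · have h0 : q.descFactorial i = 0 ∨ p.descFactorial (k - i) = 0 ∨
          s.descFactorial (k - i) = 0 ∨ r.descFactorial i = 0 := by
        simp only [Nat.descFactorial_eq_zero_iff_lt]; omega
      rcases h0 with h0 | h0 | h0 | h0 <;> simp [h0]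
  rw [Finset.sum_congr rfl hterm, ← Finset.sum_mul, ← map_sum, smul_eq_C_mul]
  simp only [binMon, transvCoeff, map_mul]
  ring

/-- Transvectants of monomials vanish when the `x`-exponent is too small. -/
lemma transvCoeff_eq_zero_of_add_lt_left {n m k p q r s : ℕ} (h : p + r < k) :
    transvCoeff n m k p q r s = 0 := by
  rw [transvCoeff, Finset.sum_eq_zero, mul_zero]
  intro i hi
  have h0 : p.descFactorial (k - i) = 0 ∨ r.descFactorial i = 0 := by
    simp only [Nat.descFactorial_eq_zero_iff_lt]; omega
  rcases h0 with h0 | h0 <;> simp [h0]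

/-- Transvectants of monomials vanish when the `y`-exponent is too small. -/
lemma transvCoeff_eq_zero_of_add_lt_right {n m k p q r s : ℕ} (h : q + s < k) :
    transvCoeff n m k p q r s = 0 := by
  rw [transvCoeff, Finset.sum_eq_zero, mul_zero]
  intro i hi
  have h0 : q.descFactorial i = 0 ∨ s.descFactorial (k - i) = 0 := by
    simp only [Nat.descFactorial_eq_zero_iff_lt]; omega
  rcases h0 with h0 | h0 <;> simp [h0]

/-- For `f = y³(αx⁷ + βy⁷) ∈ V₁₀`, the ten invariants `j₂, j₄, j₆, A₆, B₆, j₈, j₉,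
j₁₀, A₁₂, A₁₄` all vanish at `f`, while `j₁₄(f) ≠ 0` if and only if `α ≠ 0` and
`β ≠ 0`. (Hence `j₁₄` cannot be omitted from the eleven invariants defining the
nullcone of `V₁₀`.) -/
theorem j14_needed (α β : ℂ)
    (f : MvPolynomial (Fin 2) ℂ)
    (hf : f = X 1 ^ 3 * (C α * X 0 ^ 7 + C β * X 1 ^ 7)) :
    (j2 f = 0 ∧ j4 f = 0 ∧ j6 f = 0 ∧ A6 f = 0 ∧ B6 f = 0 ∧ j8 f = 0 ∧ j9 f = 0 ∧
      j10 f = 0 ∧ A12 f = 0 ∧ A14 f = 0) ∧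
    (j14 f ≠ 0 ↔ (α ≠ 0 ∧ β ≠ 0)) := by
  have hf' : f = binMon α 7 3 + binMon β 0 10 := by
    rw [hf]; simp only [binMon]; ring
  have hk : covK f = 0 := by
    simp [covK, hf', transv_add_left, transv_add_right, transv_binMon,
      transvCoeff_eq_zero_of_add_lt_left, transvCoeff_eq_zero_of_add_lt_right]
  have hm : covM f = 0 := by simp [covM, hk]
  have hj2 : j2 f = 0 := by
    simp [j2, hf', transv_add_left, transv_add_right, transv_binMon,
      transvCoeff_eq_zero_of_add_lt_left, transvCoeff_eq_zero_of_add_lt_right]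
  obtain ⟨c, d, hc, hd, hq⟩ : ∃ c d : ℂ, c ≠ 0 ∧ d ≠ 0 ∧
      covQ f = binMon (c * α ^ 2) 8 0 + binMon (d * (α * β)) 1 7 := by
    refine ⟨transvCoeff 10 10 6 7 3 7 3,
      transvCoeff 10 10 6 7 3 0 10 + transvCoeff 10 10 6 0 10 7 3, ?_, ?_, ?_⟩
    · norm_num [transvCoeff, Finset.sum_range_succ, Nat.factorial, Nat.descFactorial, Nat.choose]
    · norm_num [transvCoeff, Finset.sum_range_succ, Nat.factorial, Nat.descFactorial, Nat.choose]
    · simp only [covQ, hf', transv_add_left, transv_add_right, transv_binMon]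
      rw [transvCoeff_eq_zero_of_add_lt_left (p := 0) (r := 0) (by norm_num)]
      simp only [binMon, map_mul, map_add, map_pow, zero_mul, map_zero]
      norm_num
      ring
  obtain ⟨e, he, hkq⟩ : ∃ e : ℂ, e ≠ 0 ∧ covKq f = binMon (e * (α ^ 3 * β)) 3 1 := by
    refine ⟨(transvCoeff 8 8 6 8 0 1 7 + transvCoeff 8 8 6 1 7 8 0) * (c * d), ?_, ?_⟩
    · refine mul_ne_zero ?_ (mul_ne_zero hc hd)
      norm_num [transvCoeff, Finset.sum_range_succ, Nat.factorial, Nat.descFactorial, Nat.choose]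
    · simp only [covKq, hq, transv_add_left, transv_add_right, transv_binMon]
      rw [transvCoeff_eq_zero_of_add_lt_left (p := 1) (r := 1) (by norm_num),
        transvCoeff_eq_zero_of_add_lt_right (q := 0) (s := 0) (by norm_num)]
      simp only [binMon, map_mul, map_add, map_pow, zero_mul, map_zero]
      norm_num
      ring
  have hB6 : B6 f = 0 := by
    simp [B6, hq, transv_add_left, transv_add_right, transv_binMon,
      transvCoeff_eq_zero_of_add_lt_left, transvCoeff_eq_zero_of_add_lt_right]
  obtain ⟨t, ht, hmq⟩ : ∃ t : ℂ, t ≠ 0 ∧ covMq f = binMon (t * (α ^ 4 * β ^ 2)) 0 4 := by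
    refine ⟨transvCoeff 8 4 4 1 7 3 1 * (d * e), ?_, ?_⟩
    · refine mul_ne_zero ?_ (mul_ne_zero hd he)
      norm_num [transvCoeff, Finset.sum_range_succ, Nat.factorial, Nat.descFactorial, Nat.choose]
    · simp only [covMq, hq, hkq, transv_add_left, transv_binMon]
      rw [transvCoeff_eq_zero_of_add_lt_right (q := 0) (s := 1) (by norm_num)]
      simp only [binMon, map_mul, map_pow, zero_mul, map_zero]
      norm_num
      ring
  obtain ⟨u, hu, hj14⟩ : ∃ u : ℂ, u ≠ 0 ∧ j14 f = C (u * (α ^ 10 * β ^ 4)) := by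
    refine ⟨transvCoeff 4 4 4 4 0 0 4 * (transvCoeff 4 4 2 3 1 3 1 * (e * e) * t), ?_, ?_⟩
    · refine mul_ne_zero ?_ (mul_ne_zero (mul_ne_zero ?_ (mul_ne_zero he he)) ht)
      all_goals
        norm_num [transvCoeff, Finset.sum_range_succ, Nat.factorial, Nat.descFactorial, Nat.choose]
    · simp only [j14, hkq, hmq, transv_binMon]
      simp only [binMon, map_mul, map_pow]
      norm_num
      ring
  refine ⟨⟨hj2, ?_, ?_, ?_, hB6, ?_, ?_, ?_, ?_, ?_⟩, ?_⟩
  · simp [j4, hk]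
  · simp [j6, hk]
  · simp [A6, hm]
  · simp [j8, hk]
  · simp [j9, hk]
  · simp [j10, hk]
  · simp [A12, hk]
  · simp [A14, hk]
  · rw [hj14, Ne, C_eq_zero]
    simp [hu]
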